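/- Let ℓ be a prime with ℓ ≡ 1 (mod 4) and let p ≠ ℓ be a prime with p ≡ 3 (mod 4). If there exists a positive integer n such that H_ℓ is maximal over 𝔽_{p^{2n}}, then the order m of the image of p in the group 𝔽_ℓ^×/{±1} is odd. -/

import Mathlib

open Polynomial

/-- Number of affine points (x,y) ∈ F × F with y² = φ_d(x), where φ_d is the
d-th Chebyshev (Dickson first kind, parameter 1) polynomial over F. -/
noncomputable def chebAffineCount (F : Type) [Field F] (d : ℕ) : ℕ :=
  Nat.card {xy : F × F // xy.2 ^ 2 = (dickson 1 (1 : F) d).eval xy.1}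

/-- The hyperelliptic curve H_d : y² = φ_d(x) is maximal over the field with q² elements:
its affine point count attains q² + (d-1)q (Hasse–Weil bound minus the point at infinity). -/
def chebMaximal (d q : ℕ) : Prop :=
  ∀ (F : Type) [Field F] [Fintype F], Fintype.card F = q ^ 2 →
    chebAffineCount F d = q ^ 2 + (d - 1) * q


section ChebAux
open scoped Classical
set_option linter.unusedSectionVars false
open QuadraticAlgebra

variable {F : Type} [Field F] [Fintype F] {δ : F}

noncomputable instance quadFintype : Fintype (QuadraticAlgebra F δ 0) :=
  Fintype.ofEquiv _ (QuadraticAlgebra.equivProd δ 0).symm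

lemma sum_quad (g : QuadraticAlgebra F δ 0 → ℤ) :
    ∑ z, g z = ∑ a : F, ∑ b : F, g ⟨a, b⟩ := by
  rw [← Fintype.sum_prod_type']
  exact Fintype.sum_equiv (QuadraticAlgebra.equivProd δ 0) _ _ (fun z => by
    simp [QuadraticAlgebra.equivProd])

lemma card_quad : Fintype.card (QuadraticAlgebra F δ 0) = Fintype.card F ^ 2 := by
  rw [Fintype.card_congr (QuadraticAlgebra.equivProd δ 0), Fintype.card_prod, sq]

noncomputable def uchar (z : QuadraticAlgebra F δ 0) : ℤ := quadraticChar F z.re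

lemma sum_uchar_mul (hF : ringChar F ≠ 2) (hδ : δ ≠ 0) (w : QuadraticAlgebra F δ 0)
    (hw : w.im ≠ 0) : ∑ z, uchar z * uchar (z * w) = 0 := by
  rw [sum_quad]
  refine Finset.sum_eq_zero fun a _ => ?_
  simp only [uchar, re_mul]
  rw [← Finset.mul_sum]
  have hb : Function.Bijective (fun b : F => a * w.re + δ * b * w.im) := by
    refine Finite.injective_iff_bijective.mp ?_
    intro b c h
    have h2 : δ * w.im * (b - c) = 0 := by linear_combination h
    have := mul_ne_zero hδ hw
    rcases mul_eq_zero.mp h2 with h3 | h3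
    · exact absurd h3 this
    · exact sub_eq_zero.mp h3
  rw [hb.sum_comp (fun x => quadraticChar F x), quadraticChar_sum_zero hF, mul_zero]

lemma sum_char_sq : ∑ a : F, quadraticChar F a * quadraticChar F a = (Fintype.card F : ℤ) - 1 := by
  have h : ∀ a : F, quadraticChar F a * quadraticChar F a = 1 - if a = 0 then 1 else 0 := by
    intro a
    split_ifs with h
    · simp [h]
    · rw [← sq, quadraticChar_sq_one h]; ring
  simp only [h, Finset.sum_sub_distrib]
  simp

lemma sum_uchar_sq : ∑ z : QuadraticAlgebra F δ 0, uchar z * uchar z =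
    (Fintype.card F : ℤ) * (Fintype.card F - 1) := by
  rw [sum_quad]
  simp only [uchar]
  simp only [Finset.sum_const, Finset.card_univ, nsmul_eq_mul]
  rw [← Finset.mul_sum, sum_char_sq]

variable [hδ : Fact (∀ r : F, r ^ 2 ≠ δ + 0 * r)]

noncomputable def vsum (M : Subgroup (QuadraticAlgebra F δ 0)ˣ) (z : QuadraticAlgebra F δ 0) : ℤ :=
  ∑ s : M, uchar (z * s.1.1)

lemma delta_ne : δ ≠ 0 := by
  have := hδ.out 0
  intro h
  simp [h] at this

lemma sum_vsum_sq (hF : ringChar F ≠ 2) (M : Subgroup (QuadraticAlgebra F δ 0)ˣ)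
    (hM : ∀ s ∈ M, (s : QuadraticAlgebra F δ 0).im = 0 → s = 1) :
    ∑ z, vsum M z ^ 2 = (Nat.card M : ℤ) * (Fintype.card F * (Fintype.card F - 1)) := by
  have h1 : ∀ s s' : M, ∑ z : QuadraticAlgebra F δ 0, uchar (z * s.1.1) *
      uchar (z * s'.1.1) =
      if s = s' then (Fintype.card F : ℤ) * (Fintype.card F - 1) else 0 := by
    intro s s'
    have hb : Function.Bijective (fun z : QuadraticAlgebra F δ 0 =>
        z * (s⁻¹).1.1) :=
      (Units.mulRight_bijective _)
    rw [← hb.sum_comp]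
    simp only [mul_assoc]
    simp only [← Units.val_mul, ← Subgroup.coe_mul]
    simp only [inv_mul_cancel, OneMemClass.coe_one, Units.val_one, mul_one]
    split_ifs with h
    · subst h
      simp [sum_uchar_sq]
    · apply sum_uchar_mul hF delta_ne
      intro him
      have := hM _ (s⁻¹ * s' : M).2 him
      apply h
      have h3 : s⁻¹ * s' = 1 := Subtype.ext this
      exact (inv_mul_eq_one.mp h3)
  simp only [sq, vsum, Finset.sum_mul_sum]
  rw [Finset.sum_comm]
  simp_rw [Finset.sum_comm (s := (Finset.univ : Finset (QuadraticAlgebra F δ 0))), h1]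
  simp

lemma vsum_mul (M : Subgroup (QuadraticAlgebra F δ 0)ˣ) (f : F) (s : M)
    (z : QuadraticAlgebra F δ 0) :
    vsum M (QuadraticAlgebra.C f * s.1.1 * z) =
      quadraticChar F f * vsum M z := by
  unfold vsum
  rw [Finset.mul_sum, ← (Group.mulLeft_bijective s).sum_comp (fun t : M =>
    quadraticChar F f * uchar (z * t.1.1))]
  refine Finset.sum_congr rfl fun t _ => ?_
  have : QuadraticAlgebra.C f * s.1.1 * z *
     t.1.1 =
     QuadraticAlgebra.C f * (z * (s * t).1.1) := by
    push_cast
    ring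
  rw [this]
  unfold uchar
  rw [← map_mul]
  congr 1
  generalize z * (s * t).1.1 = y
  simp

lemma vsum_zero (M : Subgroup (QuadraticAlgebra F δ 0)ˣ) : vsum M 0 = 0 := by
  simp [vsum, uchar]

noncomputable def phiMap (M : Subgroup (QuadraticAlgebra F δ 0)ˣ) (z0 : (QuadraticAlgebra F δ 0)ˣ) :
    Option ((Fˣ × M) ⊕ (Fˣ × M)) → QuadraticAlgebra F δ 0
  | none => 0
  | some (Sum.inl x) => QuadraticAlgebra.C (x.1 : F) * x.2.1.1 * 1
  | some (Sum.inr x) => QuadraticAlgebra.C (x.1 : F) * x.2.1.1 * z0.1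

lemma C_ne_zero (f : Fˣ) : (QuadraticAlgebra.C (f : F) : QuadraticAlgebra F δ 0) ≠ 0 := by
  simp

lemma fs_inj (M : Subgroup (QuadraticAlgebra F δ 0)ˣ)
    (hM : ∀ s ∈ M, (s : QuadraticAlgebra F δ 0).im = 0 → s = 1) (f g : Fˣ) (s t : M)
    (h : (QuadraticAlgebra.C (f : F) : QuadraticAlgebra F δ 0) * s.1.1 =
      QuadraticAlgebra.C (g : F) * t.1.1) : f = g ∧ s = t := by
  have h1 : (s * t⁻¹).1.1 =
      QuadraticAlgebra.C (((f⁻¹ * g : Fˣ)) : F) := by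
    have hf := C_ne_zero (δ := δ) f
    apply mul_left_cancel₀ hf
    rw [← QuadraticAlgebra.C_mul]
    push_cast
    rw [← mul_assoc, h, mul_assoc, mul_inv_cancel₀ (Units.ne_zero _), mul_one]
    congr 1
    field_simp
  have h2 := hM _ (s * t⁻¹ : M).2 (by rw [h1]; simp)
  rw [h2] at h1
  have h3 : s = t := mul_inv_eq_one.mp (Subtype.ext h2)
  refine ⟨?_, h3⟩
  subst h3
  have := mul_right_cancel₀ (Units.ne_zero _) h
  exact Units.ext (QuadraticAlgebra.C_injective this)

lemma phiMap_inj (M : Subgroup (QuadraticAlgebra F δ 0)ˣ) (z0 : (QuadraticAlgebra F δ 0)ˣ)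
    (hM : ∀ s ∈ M, (s : QuadraticAlgebra F δ 0).im = 0 → s = 1)
    (hz : ∀ (f : Fˣ), ∀ s ∈ M, (z0 : QuadraticAlgebra F δ 0) ≠ QuadraticAlgebra.C (f : F) * s.1) :
    Function.Injective (phiMap M z0) := by
  have hne : ∀ (f : Fˣ) (s z : (QuadraticAlgebra F δ 0)ˣ),
      (QuadraticAlgebra.C (f : F) : QuadraticAlgebra F δ 0) * s * z ≠ 0 := fun f s z =>
    mul_ne_zero (mul_ne_zero (C_ne_zero f) (Units.ne_zero _)) (Units.ne_zero _)
  have hcross : ∀ (f g : Fˣ) (s t : M),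
      (QuadraticAlgebra.C (f : F) : QuadraticAlgebra F δ 0) * s.1.1 * 1 ≠
      QuadraticAlgebra.C (g : F) * t.1.1 * z0.1 := by
    intro f g s t h
    apply hz (g⁻¹ * f) _ (t⁻¹ * s : M).2
    apply mul_left_cancel₀ (C_ne_zero (δ := δ) g)
    apply mul_left_cancel₀ (Units.ne_zero t.1)
    rw [mul_one] at h
    have e : (QuadraticAlgebra.C (f : F) : QuadraticAlgebra F δ 0) =
      QuadraticAlgebra.C (g : F) * QuadraticAlgebra.C ((g⁻¹ * f : Fˣ) : F) := by
      rw [← QuadraticAlgebra.C_mul, ← Units.val_mul]; simp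
    rw [e] at h
    rw [← mul_assoc, mul_comm t.1.1, ← h]
    push_cast
    have e2 : t.1.1 * (t.1.1)⁻¹ = 1 := mul_inv_cancel₀ (Units.ne_zero _)
    linear_combination (-1) * QuadraticAlgebra.C (g : F) * QuadraticAlgebra.C ((g : F)⁻¹ * f)
      * s.1.1 * e2
  rintro (_ | (⟨f, s⟩ | ⟨f, s⟩)) (_ | (⟨g, t⟩ | ⟨g, t⟩)) h
  · rfl
  · exact absurd h.symm (hne g t 1)
  · exact absurd h.symm (hne g t z0)
  · exact absurd h (hne f s 1)
  · obtain ⟨rfl, rfl⟩ := fs_inj M hM f g s t (mul_right_cancel₀ one_ne_zero h)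
    rfl
  · exact absurd h (hcross f g s t)
  · exact absurd h (hne f s z0)
  · exact absurd h.symm (hcross g f t s)
  · obtain ⟨rfl, rfl⟩ := fs_inj M hM f g s t (mul_right_cancel₀ (Units.ne_zero _) h)
    rfl

lemma phiMap_sum (M : Subgroup (QuadraticAlgebra F δ 0)ˣ) (z0 : (QuadraticAlgebra F δ 0)ˣ) :
    ∑ x, vsum M (phiMap M z0 x) ^ 2 =
      ((Fintype.card F : ℤ) - 1) * Nat.card M * (vsum M 1 ^ 2 + vsum M z0 ^ 2) := by
  have h : ∀ f : Fˣ, quadraticChar F (f : F) ^ 2 = 1 := fun f => quadraticChar_sq_one f.ne_zero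
  have hc : ((Fintype.card Fˣ : ℕ) : ℤ) = (Fintype.card F : ℤ) - 1 := by
    rw [Fintype.card_units, Nat.cast_sub Fintype.card_pos]; simp
  simp only [Fintype.sum_option, Fintype.sum_sum_type, phiMap, vsum_zero, vsum_mul, mul_pow, h]
  simp [hc]
  ring

lemma two_values (hF : ringChar F ≠ 2) (M : Subgroup (QuadraticAlgebra F δ 0)ˣ)
    (z0 : (QuadraticAlgebra F δ 0)ˣ)
    (hM : ∀ s ∈ M, (s : QuadraticAlgebra F δ 0).im = 0 → s = 1)
    (hz : ∀ (f : Fˣ), ∀ s ∈ M, (z0 : QuadraticAlgebra F δ 0) ≠ QuadraticAlgebra.C (f : F) * s.1) :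
    vsum M 1 ^ 2 + vsum M z0 ^ 2 ≤ Fintype.card F ∧
    (2 * Nat.card M = Fintype.card F + 1 →
      vsum M 1 ^ 2 + vsum M z0 ^ 2 = Fintype.card F) := by
  have hinj := phiMap_inj M z0 hM hz
  have hQ : (0 : ℤ) < (Fintype.card F : ℤ) - 1 := by
    have := Fintype.one_lt_card (α := F)
    omega
  have hMc : (0 : ℤ) < (Nat.card M : ℤ) := by exact_mod_cast Nat.card_pos
  have hsum := phiMap_sum M z0
  have htot := sum_vsum_sq hF M hM
  constructor
  · have hle : ∑ x, vsum M (phiMap M z0 x) ^ 2 ≤ ∑ z, vsum M z ^ 2 := by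
      have e := Finset.sum_map Finset.univ ⟨_, hinj⟩ (fun z => vsum M z ^ 2)
      refine e.symm.le.trans ?_
      exact Finset.sum_le_univ_sum_of_nonneg fun z => sq_nonneg _
    rw [hsum, htot] at hle
    have : ((Fintype.card F : ℤ) - 1) * Nat.card M * (vsum M 1 ^ 2 + vsum M z0 ^ 2) ≤
      ((Fintype.card F : ℤ) - 1) * Nat.card M * Fintype.card F := by linarith
    exact le_of_mul_le_mul_left this (mul_pos hQ hMc)
  · intro hc
    have hb : Function.Bijective (phiMap M z0) := by
      rw [Fintype.bijective_iff_injective_and_card]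
      refine ⟨hinj, ?_⟩
      rw [card_quad]
      simp only [Fintype.card_option, Fintype.card_sum, Fintype.card_prod, Fintype.card_units]
      rw [Nat.card_eq_fintype_card] at hc
      have := Fintype.one_lt_card (α := F)
      zify [this.le]
      zify at hc
      linear_combination ((Fintype.card F : ℤ) - 1) * hc
    rw [hb.sum_comp (fun z => vsum M z ^ 2), htot] at hsum
    have : ((Fintype.card F : ℤ) - 1) * Nat.card M * (vsum M 1 ^ 2 + vsum M z0 ^ 2) =
      ((Fintype.card F : ℤ) - 1) * Nat.card M * Fintype.card F := by linarith
    exact mul_left_cancel₀ (mul_pos hQ hMc).ne' this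

/-- The norm one group. -/
noncomputable def muK (F : Type) [Field F] (δ : F) : Subgroup (QuadraticAlgebra F δ 0)ˣ :=
  (Units.map (QuadraticAlgebra.norm (R := F) (a := δ) (b := 0))).ker

lemma mem_muK (z : (QuadraticAlgebra F δ 0)ˣ) :
    z ∈ muK F δ ↔ z.1.re ^ 2 - δ * z.1.im ^ 2 = 1 := by
  unfold muK
  rw [MonoidHom.mem_ker, Units.ext_iff]
  simp only [Units.coe_map, Units.val_one]
  rw [QuadraticAlgebra.norm_def]
  constructor
  · intro h; linear_combination h
  · intro h; linear_combination h

lemma two_ne (hF : ringChar F ≠ 2) : (2 : F) ≠ 0 := Ring.two_ne_zero hF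

lemma card_fiber_units (hF : ringChar F ≠ 2) (x : F) :
    ((Finset.univ.filter (fun t : Fˣ => (t : F) + (t : F)⁻¹ = x)).card : ℤ) =
      quadraticChar F (x ^ 2 - 4) + 1 := by
  have h2 := two_ne hF
  rw [← quadraticChar_card_sqrts hF]
  congr 1
  refine Finset.card_bij (fun t _ => 2 * (t : F) - x) ?_ ?_ ?_
  · intro t ht
    simp only [Finset.mem_filter, Finset.mem_univ, true_and] at ht
    simp only [Set.mem_toFinset, Set.mem_ofPred_eq]
    have := t.ne_zero
    have h3 : (t : F) * (t : F)⁻¹ = 1 := mul_inv_cancel₀ this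
    rw [← ht]
    linear_combination (-4) * h3
  · intro s _ t _ h
    apply Units.ext
    apply mul_left_cancel₀ h2
    linear_combination h
  · intro w hw
    simp only [Set.mem_toFinset, Set.mem_ofPred_eq] at hw
    have h4 : ((x + w) / 2) * ((x - w) / 2) = 1 := by
      field_simp
      linear_combination (-1) * hw
    refine ⟨⟨(x + w) / 2, (x - w) / 2, h4, by rw [mul_comm]; exact h4⟩, ?_, ?_⟩
    · simp only [Finset.mem_filter, Finset.mem_univ, true_and]
      rw [inv_eq_of_mul_eq_one_right h4]
      field_simp
      ring
    · simp only
      field_simp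
      ring

lemma char_delta : quadraticChar F δ = -1 := by
  rw [quadraticChar_neg_one_iff_not_isSquare]
  rintro ⟨r, hr⟩
  exact hδ.out r (by rw [hr]; ring)

lemma card_fiber_mu (hF : ringChar F ≠ 2) (x : F) :
    ((Finset.univ.filter (fun t : muK F δ => 2 * t.1.1.re = x)).card : ℤ) =
      1 - quadraticChar F (x ^ 2 - 4) := by
  have h2 := two_ne hF
  have hd := delta_ne (δ := δ)
  have hc : quadraticChar F ((x ^ 2 - 4) * δ⁻¹) + 1 = 1 - quadraticChar F (x ^ 2 - 4) := by
    have : quadraticChar F δ⁻¹ = -1 := by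
      have h1 : quadraticChar F δ⁻¹ * quadraticChar F δ = 1 := by
        rw [← map_mul, inv_mul_cancel₀ hd, map_one]
      rw [char_delta (δ := δ)] at h1
      linarith
    rw [map_mul, this]; ring
  rw [← hc, ← quadraticChar_card_sqrts hF]
  congr 1
  refine Finset.card_bij (fun t _ => 2 * t.1.1.im) ?_ ?_ ?_
  · intro t ht
    simp only [Finset.mem_filter, Finset.mem_univ, true_and] at ht
    simp only [Set.mem_toFinset, Set.mem_ofPred_eq]
    have h3 := (mem_muK t.1).mp t.2
    rw [← ht]
    field_simp
    linear_combination (-4) * h3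
  · intro s hs t ht h
    simp only [Finset.mem_filter, Finset.mem_univ, true_and] at hs ht
    apply Subtype.ext
    apply Units.ext
    apply QuadraticAlgebra.ext
    · exact mul_left_cancel₀ h2 (hs.trans ht.symm)
    · exact mul_left_cancel₀ h2 h
  · intro w hw
    simp only [Set.mem_toFinset, Set.mem_ofPred_eq] at hw
    have h4 : (x / 2) ^ 2 - δ * (w / 2) ^ 2 = 1 := by
      rw [div_pow, div_pow, hw]
      field_simp
      ring
    have h5 : (⟨x / 2, w / 2⟩ : QuadraticAlgebra F δ 0) ≠ 0 := by
      intro h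
      have e1 : x / 2 = 0 := congrArg QuadraticAlgebra.re h
      have e2 : w / 2 = 0 := congrArg QuadraticAlgebra.im h
      rw [e1, e2] at h4
      simp at h4
    refine ⟨⟨Units.mk0 _ h5, (mem_muK _).mpr h4⟩, ?_, ?_⟩
    · simp only [Finset.mem_filter, Finset.mem_univ, true_and, Units.val_mk0]
      field_simp
    · simp only [Units.val_mk0]
      field_simp

lemma sum_comp_card {ι : Type} [Fintype ι] (h : ι → F) (g : F → ℤ) :
    ∑ t, g (h t) = ∑ x, ((Finset.univ.filter (fun t => h t = x)).card : ℤ) * g x := by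
  rw [← Finset.sum_fiberwise Finset.univ h]
  refine Finset.sum_congr rfl fun x _ => ?_
  rw [Finset.sum_congr rfl (g := fun _ => g x)]
  · simp
  · intro t ht
    simp only [Finset.mem_filter, Finset.mem_univ, true_and] at ht
    rw [ht]

lemma two_sum (hF : ringChar F ≠ 2) (g : F → ℤ) :
    ∑ t : Fˣ, g ((t : F) + (t : F)⁻¹) + ∑ t : muK F δ, g (2 * t.1.1.re) = 2 * ∑ x, g x := by
  rw [sum_comp_card (fun t : Fˣ => (t : F) + (t : F)⁻¹),
    sum_comp_card (fun t : muK F δ => 2 * t.1.1.re), ← Finset.sum_add_distrib, Finset.mul_sum]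
  refine Finset.sum_congr rfl fun x _ => ?_
  rw [card_fiber_units hF, card_fiber_mu hF]
  ring

lemma card_muK (hF : ringChar F ≠ 2) : Nat.card (muK F δ) = Fintype.card F + 1 := by
  have h := two_sum (δ := δ) hF (fun _ => 1)
  have := Fintype.one_lt_card (α := F)
  simp only [Finset.sum_const, Finset.card_univ, Fintype.card_units] at h
  rw [Nat.card_eq_fintype_card]
  simp only [nsmul_eq_mul, mul_one] at h
  omega

lemma dickson_mu (d : ℕ) (t : muK F δ) :
    (dickson 1 (1 : F) d).eval (2 * t.1.1.re) = 2 * (t ^ d).1.1.re := by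
  have h1 : ∀ s : muK F δ, s.1.1 * star s.1.1 = 1 := by
    intro s
    have := (mem_muK s.1).mp s.2
    apply QuadraticAlgebra.ext
    · simp only [re_mul, re_star, im_star]
      rw [re_one]
      linear_combination this
    · simp only [im_mul, re_star, im_star]
      rw [im_one]
      ring
  have h2 : ∀ s : muK F δ, s.1.1 + star s.1.1 = algebraMap F (QuadraticAlgebra F δ 0) (2 * s.1.1.re) := by
    intro s
    apply QuadraticAlgebra.ext
    · simp; ring
    · simp
  have h3 := dickson_one_one_eval_add_inv (t.1.1) (star t.1.1) (h1 t) d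
  have h4 : star t.1.1 ^ d = star ((t ^ d).1.1) := by
    push_cast
    rw [star_pow]
  have h5 : t.1.1 ^ d = (t ^ d).1.1 := by push_cast; rfl
  rw [h4, h5, h2, h2] at h3
  have h6 : dickson 1 (1 : QuadraticAlgebra F δ 0) d =
      (dickson 1 (1 : F) d).map (algebraMap F (QuadraticAlgebra F δ 0)) := by
    rw [map_dickson, map_one]
  rw [h6, eval_map, eval₂_hom] at h3
  exact QuadraticAlgebra.algebraMap_injective h3

lemma sum_hom {G H : Type} [CommGroup G] [Group H] [Fintype G] [Fintype H] (f : G →* H)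
    [Fintype f.range] (g : H → ℤ) :
    ∑ t, g (f t) = (Nat.card f.ker : ℤ) * ∑ s : f.range, g s := by
  rw [← Finset.sum_fiberwise Finset.univ f.rangeRestrict, Finset.mul_sum]
  refine Finset.sum_congr rfl fun y _ => ?_
  rw [Finset.sum_congr rfl (g := fun _ => g y)]
  · rw [Finset.sum_const, nsmul_eq_mul]
    congr 2
    obtain ⟨x, hx⟩ := f.rangeRestrict_surjective y
    rw [Nat.card_eq_fintype_card, Fintype.card_subtype]
    have := MonoidHom.card_fiber_eq_of_mem_range f.rangeRestrict (x := y) (y := 1) ⟨x, hx⟩ ⟨1, map_one _⟩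
    rw [this]
    congr 1
    ext a
    simp only [Finset.mem_filter, Finset.mem_univ, true_and, MonoidHom.mem_ker]
    rw [Subtype.ext_iff]
    simp
  · intro t ht
    simp only [Finset.mem_filter, Finset.mem_univ, true_and] at ht
    rw [← ht]
    rfl

noncomputable def fpow (δ : F) [Fact (∀ r : F, r ^ 2 ≠ δ + 0 * r)] (e : ℕ) :
    muK F δ →* (QuadraticAlgebra F δ 0)ˣ :=
  (muK F δ).subtype.comp (powMonoidHom e)

lemma fpow_apply (e : ℕ) (t : muK F δ) : fpow δ e t = (t ^ e : muK F δ).1 := rfl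

lemma card_fpow_ker (hF : ringChar F ≠ 2) (e : ℕ) :
    Nat.card (fpow δ e).ker = (Fintype.card F + 1).gcd e := by
  have h : (fpow δ e).ker = (powMonoidHom e : muK F δ →* muK F δ).ker := by
    ext t
    rw [MonoidHom.mem_ker, MonoidHom.mem_ker, fpow_apply]
    simp [Subtype.ext_iff]
  rw [h, IsCyclic.card_powMonoidHom_ker, card_muK hF]

lemma card_fpow_range (hF : ringChar F ≠ 2) (e : ℕ) :
    Nat.card (fpow δ e).ker * Nat.card (fpow δ e).range = Fintype.card F + 1 := by
  rw [← card_muK (δ := δ) hF, ← Subgroup.index_ker, Subgroup.card_mul_index]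

lemma range_le_mu (e : ℕ) : (fpow δ e).range ≤ muK F δ := by
  rintro _ ⟨t, rfl⟩
  exact (t ^ e).2

lemma mu_im_zero (s : (QuadraticAlgebra F δ 0)ˣ) (hs : s ∈ muK F δ) (him : s.1.im = 0) :
    s = 1 ∨ s = -1 := by
  have h := (mem_muK s).mp hs
  rw [him] at h
  have h2 : s.1.re ^ 2 = 1 := by linear_combination h
  rcases sq_eq_one_iff.mp h2 with h3 | h3
  · left
    apply Units.ext
    apply QuadraticAlgebra.ext
    · rw [h3]; rfl
    · rw [him]; rfl
  · right
    apply Units.ext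
    apply QuadraticAlgebra.ext
    · rw [h3]; rfl
    · rw [him]; simp

lemma one_ne_neg_one (hF : ringChar F ≠ 2) : (1 : (QuadraticAlgebra F δ 0)ˣ) ≠ -1 := by
  intro h
  have h1 : (1 : F) = -1 := congrArg (fun z : (QuadraticAlgebra F δ 0)ˣ => z.1.re) h
  apply two_ne hF
  linear_combination h1

lemma sub_im_zero (hF : ringChar F ≠ 2) (M : Subgroup (QuadraticAlgebra F δ 0)ˣ)
    (hM : M ≤ muK F δ) (hodd : Odd (Nat.card M)) :
    ∀ s ∈ M, (s : QuadraticAlgebra F δ 0).im = 0 → s = 1 := by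
  intro s hs him
  rcases mu_im_zero s (hM hs) him with h | h
  · exact h
  · exfalso
    have h1 : (⟨s, hs⟩ : M) ^ Nat.card M = 1 := pow_card_eq_one'
    have h2 : s ^ Nat.card M = 1 := congrArg Subtype.val h1
    rw [h, hodd.neg_one_pow] at h2
    exact one_ne_neg_one hF h2.symm

lemma re_ne_zero (hm1 : IsSquare (-1 : F)) (s : (QuadraticAlgebra F δ 0)ˣ) (hs : s ∈ muK F δ) :
    s.1.re ≠ 0 := by
  intro h0
  have h := (mem_muK s).mp hs
  rw [h0] at h
  obtain ⟨i, hi⟩ := hm1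
  have him : s.1.im ≠ 0 := by
    intro h1
    rw [h1] at h
    simp at h
  apply hδ.out (i / s.1.im)
  field_simp
  linear_combination (-1) * hi + h

lemma vsum_odd (hm1 : IsSquare (-1 : F)) (M : Subgroup (QuadraticAlgebra F δ 0)ˣ)
    (hM : M ≤ muK F δ) (hodd : Odd (Nat.card M)) (z : (QuadraticAlgebra F δ 0)ˣ)
    (hz : z ∈ muK F δ) : Odd (vsum M z.1) := by
  rw [← ZMod.intCast_eq_one_iff_odd]
  unfold vsum
  push_cast
  rw [Finset.sum_congr rfl (g := fun _ => 1)]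
  · rw [Finset.sum_const, Finset.card_univ, ← Nat.card_eq_fintype_card, nsmul_eq_mul, mul_one]
    exact (ZMod.natCast_eq_one_iff_odd).mpr hodd
  · intro s _
    have h := re_ne_zero hm1 (z * s.1) ((muK F δ).mul_mem hz (hM s.2))
    have h2 : uchar (z.1 * s.1.1) = 1 ∨ uchar (z.1 * s.1.1) = -1 := quadraticChar_dichotomy h
    rcases h2 with h2 | h2 <;> rw [h2]
    · simp
    · decide

lemma uchar_inv (s : (QuadraticAlgebra F δ 0)ˣ) (hs : s ∈ muK F δ) :
    uchar (s⁻¹).1 = uchar s.1 := by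
  have h : s * s⁻¹ = 1 := mul_inv_cancel s
  have h1 := (mem_muK s).mp hs
  have e : (s⁻¹).1 = star s.1 := by
    have h3 : s.1 * star s.1 = 1 := by
      apply QuadraticAlgebra.ext
      · simp only [re_mul, re_star, im_star]
        rw [re_one]
        linear_combination h1
      · simp only [im_mul, re_star, im_star]
        rw [im_one]
        ring
    have h4 : s.1 * (s⁻¹).1 = 1 := Units.mul_inv s
    exact mul_left_cancel₀ (Units.ne_zero s) (h4.trans h3.symm)
  rw [e]
  unfold uchar
  simp

lemma vsum_one_mod_four (hm1 : IsSquare (-1 : F)) (M : Subgroup (QuadraticAlgebra F δ 0)ˣ)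
    (hM : M ≤ muK F δ) (hodd : Odd (Nat.card M)) :
    (4 : ℤ) ∣ (Nat.card M : ℤ) - vsum M 1 := by
  set E : M → ℤ := fun s => (1 - uchar s.1.1) / 2 with hE
  have hu : ∀ s : M, uchar s.1.1 = 1 ∨ uchar s.1.1 = -1 := fun s =>
    quadraticChar_dichotomy (re_ne_zero hm1 s.1 (hM s.2))
  have h1 : ∀ s : M, uchar (1 * s.1.1) = 1 - 2 * E s := by
    intro s
    rw [one_mul, hE]
    rcases hu s with h | h <;> simp only [h] <;> norm_num
  have h2 : (Nat.card M : ℤ) - vsum M 1 = 2 * ∑ s, E s := by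
    unfold vsum
    simp only [h1, Finset.sum_sub_distrib, ← Finset.mul_sum]
    simp
  have h3 : (((∑ s, E s : ℤ)) : ZMod 2) = 0 := by
    push_cast
    refine Finset.sum_involution (fun s _ => s⁻¹) ?_ ?_ ?_ ?_
    · intro s _
      have : E s⁻¹ = E s := by
        simp only [hE]
        rw [show ((s⁻¹ : M).1.1 : QuadraticAlgebra F δ 0) = (s.1⁻¹).1 from rfl, uchar_inv s.1 (hM s.2)]
      rw [this]
      exact CharTwo.add_self_eq_zero _
    · intro s _ hs heq
      apply hs
      have h4 : s = 1 := by
        have h5 : s ^ 2 = 1 := by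
          rw [sq]; nth_rewrite 1 [← heq]; simp
        have h6 : s ^ Nat.card M = 1 := pow_card_eq_one'
        obtain ⟨k, hk⟩ := hodd
        rw [hk, pow_add, pow_mul, h5] at h6
        simpa using h6
      rw [h4]
      simp [hE, uchar, re_one]
    · intro s _; simp
    · intro s _; simp
  rw [h2]
  rw [ZMod.intCast_zmod_eq_zero_iff_dvd] at h3
  obtain ⟨k, hk⟩ := h3
  exact ⟨k, by rw [hk]; push_cast; ring⟩

lemma uchar_neg (hm1 : IsSquare (-1 : F)) (z : QuadraticAlgebra F δ 0) : uchar (-z) = uchar z := by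
  have : quadraticChar F (-1) = 1 := (quadraticChar_one_iff_isSquare (by simp)).mpr hm1
  unfold uchar
  rw [re_neg, neg_eq_neg_one_mul, map_mul, this, one_mul]

lemma sum_mu_pow (hF : ringChar F ≠ 2) (hm1 : IsSquare (-1 : F)) (R d : ℕ)
    (hR : 2 * R = Fintype.card F + 1) :
    ∑ t : muK F δ, uchar (t ^ d).1.1 =
      (Nat.card (fpow δ ((R + 1) * d)).ker : ℤ) * vsum (fpow δ ((R + 1) * d)).range 1 := by
  unfold vsum
  simp only [one_mul]
  refine Eq.trans ?_ (Eq.trans (sum_hom (fpow δ ((R + 1) * d)) (fun z => uchar z.1)) (by congr!))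
  refine Finset.sum_congr rfl fun t _ => ?_
  rw [fpow_apply]
  have h1 : (t ^ R) ^ 2 = 1 := by
    rw [← pow_mul, mul_comm, hR, ← card_muK (δ := δ) hF]
    exact pow_card_eq_one'
  have h2 : (t ^ R).1.1 ^ 2 = 1 := by
    have := congrArg (fun z : muK F δ => z.1.1) h1
    simpa using this
  have h3 : (t ^ ((R + 1) * d)).1.1 = ((t ^ R).1.1) ^ d * (t ^ d).1.1 := by
    push_cast
    ring
  rw [h3]
  rcases sq_eq_one_iff.mp h2 with h4 | h4
  · rw [h4]; simp
  · rw [h4]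
    rcases neg_one_pow_eq_or (QuadraticAlgebra F δ 0) d with h5 | h5 <;> rw [h5]
    · rw [one_mul]
    · rw [neg_one_mul, uchar_neg hm1]

lemma gcd_calc (R d : ℕ) (hd : d ∣ R) (hd0 : 0 < d) (hR : Odd R) :
    (2 * R).gcd ((R + 1) * d) = 2 * d := by
  obtain ⟨k, rfl⟩ := hd
  obtain ⟨j, hj⟩ := hR
  have e1 : 2 * (d * k) = d * (2 * k) := by ring
  have e2 : (d * k + 1) * d = d * (2 * (j + 1)) := by rw [hj]; ring
  rw [e1, e2, Nat.gcd_mul_left, Nat.gcd_mul_left]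
  have : Nat.Coprime k (j + 1) := by
    have h1 : k.gcd (j + 1) ∣ d * k + 1 := by
      rw [hj, show 2 * j + 1 + 1 = 2 * (j + 1) by ring]
      exact (Nat.gcd_dvd_right _ _).mul_left _
    have h2 : k.gcd (j + 1) ∣ d * k := (Nat.gcd_dvd_left _ _).mul_left _
    exact Nat.dvd_one.mp ((Nat.dvd_add_right h2).mp h1)
  rw [this.gcd_eq_one]
  ring

lemma sq_sum_prime (p : ℕ) (hp : p.Prime) (hp4 : p % 4 = 3) (n : ℕ) :
    ∀ a b : ℤ, Odd a → a ^ 2 + b ^ 2 = (p : ℤ) ^ (2 * n) → a = (p : ℤ) ^ n ∨ a = -(p : ℤ) ^ n := by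
  induction n with
  | zero =>
    intro a b ha h
    simp only [mul_zero, pow_zero] at h ⊢
    have ha0 : a ≠ 0 := by rintro rfl; simp at ha
    have h1 : 0 < a ^ 2 := by positivity
    have h2 : a ^ 2 = 1 := by nlinarith [sq_nonneg b]
    exact sq_eq_one_iff.mp h2
  | succ n ih =>
    intro a b ha h
    haveI : Fact p.Prime := ⟨hp⟩
    have hz : ((a : ZMod p)) ^ 2 = -((b : ZMod p)) ^ 2 := by
      have h1 : (((a ^ 2 + b ^ 2 : ℤ)) : ZMod p) = (((p : ℤ) ^ (2 * (n + 1)) : ℤ) : ZMod p) := by rw [h]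
      push_cast at h1
      rw [CharP.cast_eq_zero, zero_pow (by omega)] at h1
      linear_combination h1
    have hb : (b : ZMod p) = 0 := by
      by_contra hb
      exact ZMod.mod_four_ne_three_of_sq_eq_neg_sq' hb hz hp4
    have ha' : (a : ZMod p) = 0 := by
      rw [hb] at hz
      simpa using hz
    rw [ZMod.intCast_zmod_eq_zero_iff_dvd] at ha' hb
    obtain ⟨a', rfl⟩ := ha'
    obtain ⟨b', rfl⟩ := hb
    have hp0 : (p : ℤ) ≠ 0 := by exact_mod_cast hp.ne_zero
    have h2 : a' ^ 2 + b' ^ 2 = (p : ℤ) ^ (2 * n) := by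
      apply mul_left_cancel₀ (pow_ne_zero 2 hp0)
      rw [show 2 * (n + 1) = 2 + 2 * n by ring, pow_add] at h
      linear_combination h
    rcases ih a' b' (Int.odd_mul.mp ha).2 h2 with h3 | h3
    · left; rw [h3]; ring
    · right; rw [h3]; ring

lemma pow_mod_four (p : ℕ) (hp4 : p % 4 = 3) (n : ℕ) : (4 : ℤ) ∣ (-(p : ℤ)) ^ n - 1 := by
  have h : (4 : ℤ) ∣ (-(p : ℤ)) - 1 := by omega
  have := sub_dvd_pow_sub_pow (-(p : ℤ)) 1 n
  rw [one_pow] at this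
  exact h.trans this

lemma sign_fix (p : ℕ) (hp4 : p % 4 = 3) (n : ℕ) (a : ℤ) (h4 : (4 : ℤ) ∣ 1 - a)
    (h : a = (p : ℤ) ^ n ∨ a = -(p : ℤ) ^ n) : a = (-(p : ℤ)) ^ n := by
  have h1 := pow_mod_four p hp4 n
  have h2 : a = (-(p : ℤ)) ^ n ∨ a = -(-(p : ℤ)) ^ n := by
    rcases Nat.even_or_odd n with hn | hn
    · rw [hn.neg_pow]; exact h
    · rw [hn.neg_pow, neg_neg]; exact h.symm
  rcases h2 with h2 | h2
  · exact h2
  · omega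

lemma exists_not_mem (M : Subgroup (QuadraticAlgebra F δ 0)ˣ)
    (hc : 2 * Nat.card M = Fintype.card F + 1) :
    ∃ z0 : (QuadraticAlgebra F δ 0)ˣ, ∀ (f : Fˣ), ∀ s ∈ M,
      (z0 : QuadraticAlgebra F δ 0) ≠ QuadraticAlgebra.C (f : F) * s.1 := by
  by_contra hcon
  push Not at hcon
  choose f s hs hz using hcon
  have hinj : Function.Injective (fun z0 => ((f z0, ⟨s z0, hs z0⟩) : Fˣ × M)) := by
    intro z w h
    simp only [Prod.mk.injEq, Subtype.mk.injEq] at h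
    apply Units.ext
    rw [hz z, hz w, h.1, h.2]
  have h1 := Fintype.card_le_of_injective _ hinj
  rw [Fintype.card_prod, Fintype.card_units, Fintype.card_units, card_quad,
    ← Nat.card_eq_fintype_card (α := M)] at h1
  have h2 := Fintype.one_lt_card (α := F)
  obtain ⟨k, hk⟩ : ∃ k, Fintype.card F = k + 2 := ⟨Fintype.card F - 2, by omega⟩
  rw [hk] at h1 hc
  have h3 : (k + 2) ^ 2 - 1 = (k + 1) * (k + 3) := by
    rw [show (k + 2) ^ 2 = (k + 1) * (k + 3) + 1 by ring]; simp
  rw [h3, show k + 2 - 1 = k + 1 by omega] at h1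
  have h4 := Nat.le_of_mul_le_mul_left h1 (by omega)
  omega

lemma base_value (hF : ringChar F ≠ 2) (hm1 : IsSquare (-1 : F)) (p n : ℕ) (hp : p.Prime)
    (hp4 : p % 4 = 3) (hcard : Fintype.card F = (p ^ n) ^ 2) (R : ℕ)
    (hR : 2 * R = Fintype.card F + 1) (hR4 : R % 4 = 1) :
    ∑ t : muK F δ, uchar t.1.1 = 2 * (-(p : ℤ)) ^ n := by
  have hs := sum_mu_pow (δ := δ) hF hm1 R 1 hR
  have hRodd : Odd R := Nat.odd_iff.mpr (by omega)
  have hk : Nat.card (fpow δ ((R + 1) * 1)).ker = 2 := by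
    rw [card_fpow_ker hF, ← hR, gcd_calc R 1 (one_dvd _) one_pos hRodd]
  have hr := card_fpow_range (δ := δ) hF ((R + 1) * 1)
  rw [hk] at hs hr
  have hrR : Nat.card (fpow δ ((R + 1) * 1)).range = R := by omega
  have hle := range_le_mu (δ := δ) ((R + 1) * 1)
  generalize (fpow δ ((R + 1) * 1)).range = M at hs hr hrR hle
  have hodd : Odd (Nat.card M) := by rw [hrR]; exact hRodd
  obtain ⟨z0, hz0⟩ := exists_not_mem M hr
  have h1 := (two_values hF M z0 (sub_im_zero hF M hle hodd) hz0).2 hr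
  have h2 := vsum_odd hm1 M hle hodd 1 (one_mem _)
  have h3 := vsum_one_mod_four hm1 M hle hodd
  rw [Units.val_one] at h2
  rw [hcard] at h1
  have h4 := sq_sum_prime p hp hp4 n _ _ h2 (h1.trans (by push_cast; ring))
  have h5 := sign_fix p hp4 n _ (by rw [hrR] at h3; omega) h4
  rw [← h5]
  simp only [pow_one] at hs
  exact_mod_cast hs

lemma case_two (hF : ringChar F ≠ 2) (hm1 : IsSquare (-1 : F)) (d : ℕ) (hd1 : 1 < d)
    (q : ℕ) (hcard : Fintype.card F = q ^ 2) (R : ℕ)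
    (hR : 2 * R = Fintype.card F + 1) (hR4 : R % 4 = 1) (hd : d ∣ R) :
    (∃ k : ℤ, ∑ t : muK F δ, uchar (t ^ d).1.1 = d * k) ∧
    ∑ t : muK F δ, uchar (t ^ d).1.1 ≠ 2 * d * q := by
  have hs := sum_mu_pow (δ := δ) hF hm1 R d hR
  have hRodd : Odd R := Nat.odd_iff.mpr (by omega)
  have hk : Nat.card (fpow δ ((R + 1) * d)).ker = 2 * d := by
    rw [card_fpow_ker hF, ← hR, gcd_calc R d hd (by omega) hRodd]
  have hr := card_fpow_range (δ := δ) hF ((R + 1) * d)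
  rw [hk] at hs hr
  have hrR : d * Nat.card (fpow δ ((R + 1) * d)).range = R := by
    have : 2 * (d * Nat.card (fpow δ ((R + 1) * d)).range) = 2 * R := by rw [hR, ← hr]; ring
    omega
  have hle := range_le_mu (δ := δ) ((R + 1) * d)
  generalize (fpow δ ((R + 1) * d)).range = M at hs hr hrR hle
  refine ⟨⟨2 * vsum M 1, by rw [hs]; push_cast; ring⟩, ?_⟩
  intro hcon
  have hodd : Odd (Nat.card M) := by
    rw [← hrR] at hRodd
    exact (Nat.odd_mul.mp hRodd).2
  have hv : vsum M 1 = q := by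
    rw [hs] at hcon
    push_cast at hcon
    have : (2 * (d : ℤ)) ≠ 0 := by positivity
    exact mul_left_cancel₀ this hcon
  obtain ⟨g, hg⟩ := IsCyclic.exists_ofOrder_eq_natCard (α := muK F δ)
  rw [card_muK hF, ← hR] at hg
  have hMpos : 0 < Nat.card M := Nat.card_pos
  have hz : ∀ (f : Fˣ), ∀ s ∈ M, (g.1.1 : QuadraticAlgebra F δ 0) ≠ QuadraticAlgebra.C (f : F) * s.1 := by
    intro f s hs' heq
    have h1 : (g.1 * s⁻¹).1 = QuadraticAlgebra.C (f : F) := by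
      rw [Units.val_mul, heq, mul_assoc, Units.mul_inv, mul_one]
    have h2 := mu_im_zero (g.1 * s⁻¹) ((muK F δ).mul_mem g.2 ((muK F δ).inv_mem (hle hs')))
      (by rw [h1]; simp)
    have h3 : (g.1 * s⁻¹) ^ (2 * Nat.card M) = 1 := by
      rw [pow_mul]
      rcases h2 with h2 | h2 <;> rw [h2] <;> simp
    have h4 : s ^ Nat.card M = 1 := by
      have : (⟨s, hs'⟩ : M) ^ Nat.card M = 1 := pow_card_eq_one'
      exact congrArg Subtype.val this
    rw [mul_pow, inv_pow, mul_comm 2, pow_mul s, h4, one_pow, inv_one, mul_one] at h3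
    have h5 : g ^ (Nat.card M * 2) = 1 := Subtype.ext (by push_cast; exact h3)
    have h6 := Nat.le_of_dvd (by omega) (orderOf_dvd_of_pow_eq_one h5)
    rw [hg, ← hrR] at h6
    nlinarith
  have h1 := (two_values hF M g.1 (sub_im_zero hF M hle hodd) hz).1
  have h2 := vsum_odd hm1 M hle hodd g.1 g.2
  rw [hv, hcard] at h1
  push_cast at h1
  have h3 : vsum M g.1.1 ≠ 0 := by
    intro h; rw [h] at h2; simp at h2
  have : 0 < vsum M g.1.1 ^ 2 := by positivity
  linarith

lemma affine_count (hF : ringChar F ≠ 2) (d : ℕ) :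
    (chebAffineCount F d : ℤ) =
      Fintype.card F + ∑ x : F, quadraticChar F ((dickson 1 (1 : F) d).eval x) := by
  have h : chebAffineCount F d =
      ∑ x : F, Fintype.card {y : F // y ^ 2 = (dickson 1 (1 : F) d).eval x} := by
    unfold chebAffineCount
    rw [Nat.card_congr (Equiv.subtypeProdEquivSigmaSubtype
      (fun (x y : F) => y ^ 2 = (dickson 1 (1 : F) d).eval x)), Nat.card_eq_fintype_card,
      Fintype.card_sigma]
  rw [h]
  push_cast
  have h2 : ∀ x : F, (Fintype.card {y : F // y ^ 2 = (dickson 1 (1 : F) d).eval x} : ℤ) =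
      quadraticChar F ((dickson 1 (1 : F) d).eval x) + 1 := by
    intro x
    rw [← quadraticChar_card_sqrts hF, Set.toFinset_card]
    rfl
  simp only [h2, Finset.sum_add_distrib]
  simp
  ring

lemma char_two (h8 : Fintype.card F % 8 = 1) : quadraticChar F 2 = 1 := by
  have hF : ringChar F ≠ 2 := by
    intro h
    have := FiniteField.even_card_iff_char_two.mp h
    omega
  rw [quadraticChar_one_iff_isSquare (two_ne hF), FiniteField.isSquare_two_iff]
  omega

lemma main_sum (hF : ringChar F ≠ 2) (h8 : Fintype.card F % 8 = 1) (d : ℕ) :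
    2 * ∑ x : F, quadraticChar F ((dickson 1 (1 : F) d).eval x) =
      ∑ t : Fˣ, quadraticChar F (((t ^ d : Fˣ) : F) + ((t ^ d : Fˣ) : F)⁻¹) +
      ∑ t : muK F δ, uchar (t ^ d).1.1 := by
  rw [← two_sum (δ := δ) hF (fun x => quadraticChar F ((dickson 1 (1 : F) d).eval x))]
  congr 1
  · refine Finset.sum_congr rfl fun t _ => ?_
    rw [dickson_one_one_eval_add_inv (t : F) _ (mul_inv_cancel₀ t.ne_zero)]
    simp
  · refine Finset.sum_congr rfl fun t _ => ?_
    rw [dickson_mu, map_mul, char_two h8, one_mul]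
    rfl

lemma plus_coprime (d : ℕ) (hc : Nat.Coprime (Fintype.card F - 1) d) :
    ∑ t : Fˣ, quadraticChar F (((t ^ d : Fˣ) : F) + ((t ^ d : Fˣ) : F)⁻¹) =
    ∑ t : Fˣ, quadraticChar F ((t : F) + (t : F)⁻¹) := by
  have hc' : (Nat.card Fˣ).Coprime d := by
    rw [Nat.card_eq_fintype_card, Fintype.card_units]; exact hc
  exact Fintype.sum_equiv (powCoprime hc') _ _ (fun t => rfl)

lemma minus_coprime (hF : ringChar F ≠ 2) (d : ℕ) (hc : Nat.Coprime (Fintype.card F + 1) d) :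
    ∑ t : muK F δ, uchar (t ^ d).1.1 = ∑ t : muK F δ, uchar t.1.1 := by
  have hc' : (Nat.card (muK F δ)).Coprime d := by
    rw [card_muK hF]; exact hc
  exact Fintype.sum_equiv (powCoprime hc') _ _ (fun t => rfl)

lemma plus_one (hF : ringChar F ≠ 2) (h8 : Fintype.card F % 8 = 1) :
    ∑ t : Fˣ, quadraticChar F ((t : F) + (t : F)⁻¹) = - ∑ t : muK F δ, uchar t.1.1 := by
  have h := main_sum (δ := δ) hF h8 1
  simp only [dickson_one, eval_X, pow_one, quadraticChar_sum_zero hF] at h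
  linarith

lemma plus_dvd (d : ℕ) (hd : d ∣ Fintype.card F - 1) :
    ∃ k : ℤ, ∑ t : Fˣ, quadraticChar F (((t ^ d : Fˣ) : F) + ((t ^ d : Fˣ) : F)⁻¹) = d * k := by
  have h := sum_hom (powMonoidHom d : Fˣ →* Fˣ) (fun s => quadraticChar F ((s : F) + (s : F)⁻¹))
  rw [IsCyclic.card_powMonoidHom_ker, Nat.card_eq_fintype_card, Fintype.card_units,
    Nat.gcd_eq_right hd] at h
  exact ⟨_, h⟩

/-- The heart of the argument: a maximal curve forces `n` odd and `l ∣ p ^ (2 n) - 1`. -/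
lemma core (F : Type) [Field F] [Fintype F] (l p n : ℕ) (hl : l.Prime) (hl4 : l % 4 = 1)
    (hp : p.Prime) (hp4 : p % 4 = 3) (hne : p ≠ l)
    (hcard : Fintype.card F = (p ^ n) ^ 2)
    (h : chebAffineCount F l = (p ^ n) ^ 2 + (l - 1) * p ^ n) :
    Odd n ∧ l ∣ (p ^ n) ^ 2 - 1 := by
  have hqodd : Odd (p ^ n) := (Nat.odd_iff.mpr (by omega)).pow
  have h8 : Fintype.card F % 8 = 1 := by
    rw [hcard]
    have h2 := Nat.odd_iff.mp hqodd
    have h3 : p ^ n % 8 = 1 ∨ p ^ n % 8 = 3 ∨ p ^ n % 8 = 5 ∨ p ^ n % 8 = 7 := by omega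
    rw [Nat.pow_mod (p ^ n) 2 8]
    rcases h3 with h3 | h3 | h3 | h3 <;> rw [h3]
  have hF : ringChar F ≠ 2 := by
    intro h
    have := FiniteField.even_card_iff_char_two.mp h
    omega
  have hm1 : IsSquare (-1 : F) := by
    rw [FiniteField.isSquare_neg_one_iff]; omega
  obtain ⟨δ, hδ⟩ := FiniteField.exists_nonsquare hF
  haveI : Fact (∀ r : F, r ^ 2 ≠ δ + 0 * r) := ⟨fun r hr => hδ ⟨r, by
    rw [← sq, hr]; ring⟩⟩
  obtain ⟨R, hR⟩ : ∃ R, 2 * R = Fintype.card F + 1 := ⟨(Fintype.card F + 1) / 2, by omega⟩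
  have hR4 : R % 4 = 1 := by omega
  have hS := main_sum (δ := δ) hF h8 l
  have hcount := affine_count hF l
  have hl2 : 2 ≤ l := hl.two_le
  have hq0 : 0 < p ^ n := pow_pos hp.pos n
  have hT : ∑ x : F, quadraticChar F ((dickson 1 (1 : F) l).eval x) = ((l : ℤ) - 1) * (p : ℤ) ^ n := by
    rw [h, hcard] at hcount
    push_cast [Nat.cast_sub (show 1 ≤ l by omega)] at hcount
    linarith
  rw [hT] at hS
  have hbase := base_value (δ := δ) hF hm1 p n hp hp4 hcard R hR hR4
  have hplus := plus_one (δ := δ) hF h8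
  have hndvd : ¬ (l : ℤ) ∣ 4 * (p : ℤ) ^ n := by
    intro hd
    have hd' : l ∣ 4 * p ^ n := by exact_mod_cast hd
    rcases hl.dvd_mul.mp hd' with h1 | h1
    · have := Nat.le_of_dvd (by norm_num) h1
      interval_cases l <;> omega
    · exact hne ((Nat.prime_dvd_prime_iff_eq hl hp).mp (hl.dvd_of_dvd_pow h1)).symm
  have hQ1 : 1 ≤ Fintype.card F := by omega
  by_cases hA : l ∣ Fintype.card F - 1
  · refine ⟨?_, hcard ▸ hA⟩
    have hcop : Nat.Coprime (Fintype.card F + 1) l := by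
      rw [Nat.coprime_comm, hl.coprime_iff_not_dvd]
      intro hB
      have : l ∣ 2 := by
        have := Nat.dvd_sub hB hA
        rwa [show Fintype.card F + 1 - (Fintype.card F - 1) = 2 by omega] at this
      have := Nat.le_of_dvd (by norm_num) this
      omega
    rw [minus_coprime hF l hcop, hbase] at hS
    obtain ⟨k, hk⟩ := plus_dvd (F := F) l hA
    rw [hk] at hS
    by_contra hodd
    rw [Nat.not_odd_iff_even] at hodd
    rw [hodd.neg_pow] at hS
    exact hndvd ⟨2 * (p : ℤ) ^ n - k, by linear_combination -hS⟩
  · exfalso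
    have hcopA : Nat.Coprime (Fintype.card F - 1) l := by
      rw [Nat.coprime_comm, hl.coprime_iff_not_dvd]; exact hA
    rw [plus_coprime l hcopA, hplus, hbase] at hS
    by_cases hB : l ∣ Fintype.card F + 1
    · have hlR : l ∣ R := by
        rw [← hR] at hB
        rcases hl.dvd_mul.mp hB with h1 | h1
        · have := Nat.le_of_dvd (by norm_num) h1
          omega
        · exact h1
      obtain ⟨⟨k, hk⟩, hc2⟩ := case_two (δ := δ) hF hm1 l (by omega) (p ^ n) hcard R hR hR4 hlR
      rcases Nat.even_or_odd n with hn | hn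
      · rw [hn.neg_pow] at hS
        apply hc2
        push_cast
        linear_combination -hS
      · rw [hn.neg_pow, hk] at hS
        exact hndvd ⟨2 * (p : ℤ) ^ n - k, by linear_combination -hS⟩
    · have hcop : Nat.Coprime (Fintype.card F + 1) l := by
        rw [Nat.coprime_comm, hl.coprime_iff_not_dvd]; exact hB
      rw [minus_coprime hF l hcop, hbase] at hS
      have h1 : 0 < ((l : ℤ) - 1) * (p : ℤ) ^ n := by
        apply mul_pos
        · have : (2 : ℤ) ≤ l := by exact_mod_cast hl2
          linarith
        · exact_mod_cast hq0
      linarith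

end ChebAux

theorem statement3 (l p : ℕ) (hl : l.Prime) (hl4 : l % 4 = 1)
    (hp : p.Prime) (hp4 : p % 4 = 3) (hne : p ≠ l)
    (u : (ZMod l)ˣ) (hu : (u : ZMod l) = (p : ZMod l)) (m : ℕ)
    (hm : m = orderOf (QuotientGroup.mk u :
      (ZMod l)ˣ ⧸ Subgroup.zpowers (-1 : (ZMod l)ˣ)))
    (h : ∃ n, 0 < n ∧ chebMaximal l (p ^ n)) :
    Odd m := by
  obtain ⟨n, hn, hmax⟩ := h
  haveI : Fact p.Prime := ⟨hp⟩
  haveI : Fact l.Prime := ⟨hl⟩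
  haveI : Fintype (GaloisField p (2 * n)) := Fintype.ofFinite _
  have hcard : Fintype.card (GaloisField p (2 * n)) = (p ^ n) ^ 2 := by
    rw [← Nat.card_eq_fintype_card, GaloisField.card p (2 * n) (by omega)]
    ring
  obtain ⟨hodd, hdvd⟩ := core (GaloisField p (2 * n)) l p n hl hl4 hp hp4 hne hcard
    (hmax _ hcard)
  have hq : 1 ≤ (p ^ n) ^ 2 := Nat.one_le_pow _ _ (pow_pos hp.pos n)
  have h1 : ((u : ZMod l) ^ n) ^ 2 = 1 := by
    rw [hu]
    have h2 := (ZMod.natCast_eq_zero_iff _ _).mpr hdvd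
    rw [Nat.cast_sub hq] at h2
    push_cast at h2
    exact sub_eq_zero.mp h2
  have h3 : u ^ n ∈ Subgroup.zpowers (-1 : (ZMod l)ˣ) := by
    rcases sq_eq_one_iff.mp h1 with h4 | h4
    · have : u ^ n = 1 := Units.ext (by push_cast; exact h4)
      rw [this]; exact one_mem _
    · have : u ^ n = -1 := Units.ext (by push_cast; exact h4)
      rw [this]; exact Subgroup.mem_zpowers _
  have h5 : (QuotientGroup.mk u : (ZMod l)ˣ ⧸ Subgroup.zpowers (-1 : (ZMod l)ˣ)) ^ n = 1 := by
    rw [← QuotientGroup.mk_pow, QuotientGroup.eq_one_iff]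
    exact h3
  have h6 : m ∣ n := hm ▸ orderOf_dvd_of_pow_eq_one h5
  exact hodd.of_dvd_nat h6
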